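/- arXiv:1710.07070 — 2 statements merged into one kernel-verified Lean document; each statement's English description precedes it below -/
import Mathlib

section
/- The space 𝔐₁^ψ(E) endowed with the ψ-weak topology is a Polish space, and the ψ-weak topology is generated by the distance d_ψ(μ,ν) = π(μ,ν) + |∫ψ dμ − ∫ψ dν|. -/
open MeasureTheory Filter Topology
open scoped ENNReal NNReal

/-- The one-sided Prohorov distance
`π(μ,ν) = inf {ε > 0 : μ(B) ≤ ν(Bᵉ) + ε for every Borel set B}`. -/
noncomputable def prohorovDist {E : Type*} [PseudoMetricSpace E] [MeasurableSpace E]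
    (μ ν : MeasureTheory.Measure E) : ℝ :=
  sInf {ε : ℝ | 0 < ε ∧ ∀ B : Set E, MeasurableSet B →
    μ B ≤ ν (Metric.thickening ε B) + ENNReal.ofReal ε}

/-- The distance `d_ψ(μ,ν) = π(μ,ν) + |∫ψ dμ − ∫ψ dν|`. -/
noncomputable def dPsi {E : Type*} [PseudoMetricSpace E] [MeasurableSpace E] (ψ : E → ℝ)
    (μ ν : MeasureTheory.Measure E) : ℝ :=
  prohorovDist μ ν + |(∫ x, ψ x ∂μ) - ∫ x, ψ x ∂ν|

/-- The space `𝔐₁^ψ(E)` of Borel probability measures integrating the gauge `ψ`. -/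
abbrev MPsi (E : Type*) [MeasurableSpace E] (ψ : E → ℝ) : Type _ :=
  {μ : MeasureTheory.ProbabilityMeasure E // MeasureTheory.Integrable ψ (μ : MeasureTheory.Measure E)}

/-- The `ψ`-weak topology on `𝔐₁^ψ(E)`: the coarsest topology making `μ ↦ ∫ f dμ`
continuous for every continuous `f : E → ℝ` with `|f| ≤ C·ψ` for some constant `C`. -/
noncomputable def psiWeakTopology (E : Type*) [MeasurableSpace E] [TopologicalSpace E]
    (ψ : E → ℝ) : TopologicalSpace (MPsi E ψ) :=
  ⨅ f : {f : E → ℝ // Continuous f ∧ ∃ C : ℝ, ∀ x, |f x| ≤ C * ψ x},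
    TopologicalSpace.induced (fun μ => ∫ x, f.1 x ∂(μ.1 : MeasureTheory.Measure E)) inferInstance

namespace MeasureTheory

section Polish

/-- The space of probability measures on a second countable space is second countable. -/
theorem secondCountableTopology_probabilityMeasure {E : Type*} [TopologicalSpace E]
    [MeasurableSpace E] [SecondCountableTopology E] [HasOuterApproxClosed E]
    [OpensMeasurableSpace E] : SecondCountableTopology (ProbabilityMeasure E) := by
  let B := TopologicalSpace.countableBasis E
  have hB := TopologicalSpace.isBasis_countableBasis E
  let I : Set (Finset (Set E)) := {T | (T : Set (Set E)) ⊆ B}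
  have hI : I.Countable := by
    have h := Set.countable_ofPred_finite_subset (TopologicalSpace.countable_countableBasis E)
    refine (h.preimage Finset.coe_injective).mono fun T hT => ?_
    exact ⟨T.finite_toSet, hT⟩
  let V : Finset (Set E) × ℚ → Set (ProbabilityMeasure E) := fun p =>
    {ν | Real.toNNReal p.2 < ν (⋃ t ∈ p.1, t)}
  let S : Set (Set (ProbabilityMeasure E)) := V '' (I ×ˢ Set.univ)
  have hS : S.Countable := (hI.prod Set.countable_univ).image _
  refine ⟨S, hS, le_antisymm ?_ ?_⟩
  · refine le_generateFrom ?_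
    rintro _ ⟨⟨T, q⟩, ⟨hT, -⟩, rfl⟩
    have hU : IsOpen (⋃ t ∈ T, t) := isOpen_biUnion fun t ht => hB.isOpen (hT ht)
    rw [isOpen_iff_mem_nhds]
    intro ν hν
    have hlim := ProbabilityMeasure.le_liminf_measure_open_of_tendsto
      (Filter.tendsto_id (x := 𝓝 ν)) hU
    have hlt : (Real.toNNReal q : ℝ≥0∞) < (ν : Measure E) (⋃ t ∈ T, t) := by
      rw [← ProbabilityMeasure.ennreal_coeFn_eq_coeFn_toMeasure]
      exact ENNReal.coe_lt_coe.2 hν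
    filter_upwards [eventually_lt_of_lt_liminf (hlt.trans_le hlim)] with κ hκ
    rw [id, ← ProbabilityMeasure.ennreal_coeFn_eq_coeFn_toMeasure] at hκ
    exact ENNReal.coe_lt_coe.1 hκ
  · let τ := TopologicalSpace.generateFrom S
    have hτ : @SecondCountableTopology _ τ := ⟨S, hS, rfl⟩
    rw [← continuous_id_iff_le, @continuous_iff_continuousAt _ _ τ]
    intro ν
    have : (@nhds _ τ ν).IsCountablyGenerated :=
      (@TopologicalSpace.SecondCountableTopology.to_firstCountableTopology _ τ hτ).nhds_generated_countable ν
    refine tendsto_of_forall_isOpen_le_liminf fun G hG => ?_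
    have : (@nhds _ τ ν).NeBot := @nhds_neBot _ τ ν
    refine (le_liminf_iff (isCoboundedUnder_ge_of_le (x := 1) _ (by simp))
      (by isBoundedDefault)).2 fun r hr => ?_
    obtain ⟨T, hTB, hrT, hTG⟩ := ν.exists_lt_measure_biUnion_of_isOpen (S := B)
      (fun u hu x hx => by
        obtain ⟨s, hs, hxs, hsu⟩ := hB.exists_subset_of_mem_open hx hu
        exact ⟨s, hs, (hB.isOpen hs).mem_nhds hxs, hsu⟩) hG hr
    obtain ⟨q, -, hrq, hq⟩ := (NNReal.lt_iff_exists_rat_btwn _ _).1 hrT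
    have hopen : IsOpen[τ] (V (T, q)) :=
      TopologicalSpace.isOpen_generateFrom_of_mem ⟨(T, q), ⟨hTB, trivial⟩, rfl⟩
    have hV : V (T, q) ∈ @nhds _ τ ν := (@IsOpen.mem_nhds_iff _ τ ν _ hopen).2 hq
    filter_upwards [hV] with κ hκ
    exact hrq.trans (lt_of_lt_of_le hκ (ProbabilityMeasure.apply_mono _ hTG))

theorem exists_isCompact_forall_measure_compl_le {E : Type*} [TopologicalSpace E] [PolishSpace E]
    [MeasurableSpace E] [BorelSpace E] {t : Set (ProbabilityMeasure E)} (ht : t.Finite)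
    {ε : ℝ≥0∞} (hε : 0 < ε) :
    ∃ K : Set E, IsCompact K ∧ ∀ μ ∈ t, (μ : Measure E) Kᶜ ≤ ε := by
  have h (μ : ProbabilityMeasure E) : ∃ K : Set E, IsCompact K ∧ (μ : Measure E) Kᶜ ≤ ε := by
    obtain ⟨K, hK, h⟩ := isTightMeasureSet_iff_exists_isCompact_measure_compl_le.1
      (isTightMeasureSet_singleton (μ := (μ : Measure E))) ε hε
    exact ⟨K, hK, h _ rfl⟩
  choose K hK hμ using h
  refine ⟨⋃ μ ∈ t, K μ, ht.isCompact_biUnion fun μ _ => hK μ, fun μ hμt => ?_⟩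
  exact (measure_mono (Set.compl_subset_compl.2 (Set.subset_biUnion_of_mem hμt))).trans (hμ μ)

/-- In a complete separable metric space, a set of probability measures which is totally bounded
for the Lévy-Prokhorov distance is tight. -/
theorem isTightMeasureSet_of_totallyBounded {E : Type*} [MetricSpace E] [CompleteSpace E]
    [SecondCountableTopology E] [MeasurableSpace E] [BorelSpace E]
    {S : Set (LevyProkhorov (ProbabilityMeasure E))} (hS : TotallyBounded S) :
    IsTightMeasureSet {x : Measure E | ∃ μ ∈ S, (μ.toMeasure : Measure E) = x} := by
  have key (δ : ℝ≥0) (hδ : 0 < δ) : ∃ K : Set E, IsCompact K ∧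
      ∀ μ ∈ S, (μ.toMeasure : Measure E) (Metric.cthickening δ K)ᶜ ≤ 2 * δ := by
    obtain ⟨t, ht, hSt⟩ := Metric.totallyBounded_iff.1 hS δ hδ
    obtain ⟨K, hK, hKt⟩ := exists_isCompact_forall_measure_compl_le
      (ht.image LevyProkhorov.toMeasure) (ε := δ) (by simpa using hδ)
    refine ⟨K, hK, fun μ hμ => ?_⟩
    obtain ⟨ν, hν, hμν⟩ := Set.mem_iUnion₂.1 (hSt hμ)
    have hKν := hKt _ ⟨ν, hν, rfl⟩
    have hlt : levyProkhorovEDist (μ.toMeasure : Measure E) (ν.toMeasure : Measure E) < δ := by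
      rw [← LevyProkhorov.edist_probabilityMeasure_def, edist_lt_coe]
      exact hμν
    have h := left_measure_le_of_levyProkhorovEDist_lt hlt
      (Metric.isClosed_cthickening (δ := δ) (E := K)).isOpen_compl.measurableSet
    refine h.trans ?_
    rw [two_mul]
    gcongr
    refine (measure_mono ?_).trans hKν
    intro x hx hxK
    obtain ⟨y, hy, hxy⟩ := Metric.mem_thickening_iff.1 hx
    refine hy (Metric.mem_cthickening_of_dist_le y x δ K hxK ?_)
    rw [dist_comm]
    simpa using hxy.le
  rw [isTightMeasureSet_iff_exists_isCompact_measure_compl_le]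
  intro ε hε
  obtain ⟨e, he, hsum⟩ := ENNReal.exists_pos_sum_of_countable hε.ne' ℕ
  let δ : ℕ → ℝ≥0 := fun k => min (e k / 2) (1 / (k + 1))
  have hδ (k) : 0 < δ k := lt_min (half_pos (he k)) (by positivity)
  choose K hK hKS using fun k => key (δ k) (hδ k)
  refine ⟨⋂ k, Metric.cthickening (δ k) (K k), ?_, ?_⟩
  · refine TotallyBounded.isCompact_of_isClosed ?_
      (isClosed_iInter fun _ => Metric.isClosed_cthickening)
    refine Metric.totallyBounded_iff.2 fun r hr => ?_
    obtain ⟨k, hk⟩ := exists_nat_one_div_lt (half_pos hr)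
    obtain ⟨t, ht, hKt⟩ := Metric.totallyBounded_iff.1 (hK k).totallyBounded (r / 2) (half_pos hr)
    refine ⟨t, ht, fun x hx => ?_⟩
    have hδk' : δ k ≤ 1 / (k + 1) := min_le_right _ _
    have hδk : (δ k : ℝ) < r / 2 := lt_of_le_of_lt (by exact_mod_cast hδk') hk
    have hx' := Metric.cthickening_subset_thickening' (half_pos hr) hδk _ (Set.mem_iInter.1 hx k)
    obtain ⟨y, hy, hxy⟩ := Metric.mem_thickening_iff.1 hx'
    obtain ⟨z, hz, hyz⟩ := Set.mem_iUnion₂.1 (hKt hy)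
    refine Set.mem_iUnion₂.2 ⟨z, hz, ?_⟩
    rw [Metric.mem_ball] at hyz ⊢
    linarith [dist_triangle x y z]
  · rintro _ ⟨μ, hμ, rfl⟩
    rw [Set.compl_iInter]
    refine (measure_iUnion_le _).trans (le_trans (ENNReal.tsum_le_tsum fun k => ?_) hsum.le)
    refine (hKS k μ hμ).trans ?_
    have : 2 * δ k ≤ e k := by
      calc 2 * δ k ≤ 2 * (e k / 2) := by gcongr; exact min_le_left _ _
        _ = e k := by ring
    exact_mod_cast this

/-- The Lévy-Prokhorov distance on the probability measures of a complete separable metric space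
is complete. -/
theorem completeSpace_levyProkhorov {E : Type*} [MetricSpace E] [CompleteSpace E]
    [SecondCountableTopology E] [MeasurableSpace E] [BorelSpace E] :
    CompleteSpace (LevyProkhorov (ProbabilityMeasure E)) := by
  refine Metric.complete_of_cauchySeq_tendsto fun u hu => ?_
  have htight := isTightMeasureSet_of_totallyBounded hu.totallyBounded_range
  have hcomp : IsCompact (closure (Set.range fun n => (u n).toMeasure)) := by
    refine isCompact_closure_of_isTightMeasureSet (htight.subset ?_)
    rintro _ ⟨_, ⟨n, rfl⟩, rfl⟩
    exact ⟨u n, ⟨n, rfl⟩, rfl⟩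
  obtain ⟨μ, -, φ, hφ, hlim⟩ := hcomp.tendsto_subseq fun n => subset_closure ⟨n, rfl⟩
  exact ⟨.ofMeasure μ, tendsto_nhds_of_cauchySeq_of_subseq hu hφ.tendsto_atTop
    ((LevyProkhorov.continuous_ofMeasure_probabilityMeasure.tendsto μ).comp hlim)⟩

/-- The space of probability measures on a Polish space is Polish. -/
theorem polishSpace_probabilityMeasure {E : Type*} [TopologicalSpace E] [PolishSpace E]
    [MeasurableSpace E] [BorelSpace E] : PolishSpace (ProbabilityMeasure E) := by
  let := TopologicalSpace.upgradeIsCompletelyMetrizable E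
  have := secondCountableTopology_probabilityMeasure (E := E)
  have h := LevyProkhorov.probabilityMeasureHomeomorph (Ω := E)
  have := h.symm.secondCountableTopology
  have := completeSpace_levyProkhorov (E := E)
  exact h.isClosedEmbedding.polishSpace

end Polish

end MeasureTheory

theorem integrable_of_abs_le_mul {E : Type*} [TopologicalSpace E] [MeasurableSpace E]
    [OpensMeasurableSpace E] {f ψ : E → ℝ} (hf : Continuous f) {C : ℝ}
    (hC : ∀ x, |f x| ≤ C * ψ x) {μ : Measure E} (hψ : Integrable ψ μ) : Integrable f μ :=
  (hψ.const_mul C).mono' hf.measurable.aestronglyMeasurable (ae_of_all _ hC)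

section Semicontinuity

variable {E X : Type*} [TopologicalSpace E] [MeasurableSpace E] [OpensMeasurableSpace E]
  [TopologicalSpace X] {m : X → ProbabilityMeasure E}

/-- The integral of a nonnegative continuous function is lower semicontinuous along a weakly
continuous family of probability measures that integrate it. -/
theorem lowerSemicontinuous_integral_of_nonneg (hm : Continuous m) {h : E → ℝ} (hh : Continuous h)
    (h0 : ∀ x, 0 ≤ h x) (hint : ∀ i, Integrable h (m i : Measure E)) :
    LowerSemicontinuous fun i => ∫ x, h x ∂(m i : Measure E) := by
  intro i a ha
  have hlim : Tendsto (fun n : ℕ => ∫ x, min (h x) n ∂(m i : Measure E)) atTop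
      (𝓝 (∫ x, h x ∂(m i : Measure E))) := by
    refine tendsto_integral_of_dominated_convergence h
      (fun n => (hh.min continuous_const).measurable.aestronglyMeasurable) (hint i)
      (fun n => ae_of_all _ fun x => ?_) (ae_of_all _ fun x => ?_)
    · rw [Real.norm_of_nonneg (le_min (h0 x) n.cast_nonneg)]
      exact min_le_left _ _
    · refine tendsto_const_nhds.congr' ?_
      filter_upwards [eventually_ge_atTop ⌈h x⌉₊] with n hn
      exact (min_eq_left (Nat.ceil_le.1 hn)).symm
  obtain ⟨n, hn⟩ := (hlim.eventually_const_lt ha).exists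
  let g : BoundedContinuousFunction E ℝ :=
    .ofNormedAddCommGroup (fun x => min (h x) n) (hh.min continuous_const) n fun x => by
      rw [Real.norm_of_nonneg (le_min (h0 x) n.cast_nonneg)]
      exact min_le_right _ _
  have hg := ProbabilityMeasure.continuous_iff_forall_continuous_integral.1 hm g
  filter_upwards [hg.continuousAt.eventually_const_lt hn] with j hj
  exact hj.trans_le (integral_mono (g.integrable _) (hint j) fun x => min_le_left _ _)

theorem continuous_integral_of_abs_le_mul (hm : Continuous m) {ψ : E → ℝ} (hψ : Continuous ψ)
    (hint : ∀ i, Integrable ψ (m i : Measure E))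
    (hcont : Continuous fun i => ∫ x, ψ x ∂(m i : Measure E)) {f : E → ℝ} (hf : Continuous f)
    {C : ℝ} (hC : ∀ x, |f x| ≤ C * ψ x) :
    Continuous fun i => ∫ x, f x ∂(m i : Measure E) := by
  have lsc {f : E → ℝ} (hf : Continuous f) (hC : ∀ x, |f x| ≤ C * ψ x) :
      LowerSemicontinuous fun i => ∫ x, f x ∂(m i : Measure E) := by
    have hfi (i) := integrable_of_abs_le_mul hf hC (hint i)
    have h := (lowerSemicontinuous_integral_of_nonneg hm (hf.add (hψ.const_mul C))
      (fun x => by simp only [Pi.add_apply]; linarith [neg_abs_le (f x), hC x])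
      (fun i => (hfi i).add ((hint i).const_mul C))).add
      (hcont.const_mul (-C)).lowerSemicontinuous
    refine (congrArg LowerSemicontinuous (funext fun i => ?_)).mpr h
    rw [integral_add' (hfi i) ((hint i).const_mul C), integral_const_mul]
    ring
  refine continuous_iff_lower_upperSemicontinuous.2 ⟨lsc hf hC, fun i a ha => ?_⟩
  have h := lsc hf.neg (by simpa using hC) i (-a) (by simpa [integral_neg] using ha)
  filter_upwards [h] with j hj
  simpa [integral_neg] using hj

end Semicontinuity

theorem prohorovDist_eq_levyProkhorovDist {E : Type*} [PseudoMetricSpace E] [MeasurableSpace E]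
    [OpensMeasurableSpace E] (μ ν : Measure E) [IsProbabilityMeasure μ] [IsProbabilityMeasure ν] :
    prohorovDist μ ν = levyProkhorovDist μ ν := by
  refine le_antisymm (le_of_forall_gt_imp_ge_of_dense fun c hc => ?_)
    (le_csInf ⟨1, one_pos, fun B _ => ?_⟩ ?_)
  · have hc0 : 0 < c := ENNReal.toReal_nonneg.trans_lt hc
    refine csInf_le ⟨0, fun ε hε => hε.1.le⟩ ⟨hc0, fun B hB => ?_⟩
    have hlt : levyProkhorovEDist μ ν < ENNReal.ofReal c :=
      (ENNReal.lt_ofReal_iff_toReal_lt (levyProkhorovEDist_ne_top μ ν)).2 hc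
    simpa [ENNReal.toReal_ofReal hc0.le] using left_measure_le_of_levyProkhorovEDist_lt hlt hB
  · simpa using prob_le_one.trans le_add_self
  · rintro ε ⟨hε, h⟩
    refine levyProkhorovDist_le_of_forall_le μ ν hε.le fun ε' B hεε' hB => (h B hB).trans ?_
    gcongr

theorem integrable_exp_neg_log {E : Type*} [TopologicalSpace E] [MeasurableSpace E]
    [OpensMeasurableSpace E] {ψ : E → ℝ} (hψc : Continuous ψ) (hψ1 : ∀ x, 1 ≤ ψ x)
    (μ : Measure E) [IsFiniteMeasure μ] :
    Integrable (fun x => Real.exp (-Real.log (ψ x))) μ := by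
  refine (integrable_const (1 : ℝ)).mono' ?_ (ae_of_all _ fun x => ?_)
  · exact (Real.measurable_exp.comp
      (Real.measurable_log.comp hψc.measurable).neg).aestronglyMeasurable
  · rw [Real.norm_of_nonneg (Real.exp_pos _).le, Real.exp_le_one_iff]
    exact neg_nonpos.2 (Real.log_nonneg (hψ1 x))

section Psi

variable {E : Type*} [MeasurableSpace E] {ψ : E → ℝ}

theorem continuous_integral_psiWeakTopology [TopologicalSpace E] {f : E → ℝ} (hf : Continuous f)
    {C : ℝ} (hC : ∀ x, |f x| ≤ C * ψ x) :
    Continuous[psiWeakTopology E ψ, _] fun μ : MPsi E ψ => ∫ x, f x ∂(μ.1 : Measure E) :=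
  continuous_iInf_dom (i := ⟨f, hf, C, hC⟩) continuous_induced_dom

theorem continuous_psiWeakTopology_iff [TopologicalSpace E] {X : Type*} [TopologicalSpace X]
    {m : X → MPsi E ψ} : Continuous[_, psiWeakTopology E ψ] m ↔
      ∀ f : E → ℝ, Continuous f → (∃ C : ℝ, ∀ x, |f x| ≤ C * ψ x) →
        Continuous fun i => ∫ x, f x ∂((m i).1 : Measure E) := by
  rw [psiWeakTopology, continuous_iInf_rng]
  simp only [continuous_induced_rng, Subtype.forall, and_imp]
  rfl

theorem continuous_val_psiWeakTopology [TopologicalSpace E] [OpensMeasurableSpace E]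
    (hψ1 : ∀ x, 1 ≤ ψ x) :
    Continuous[psiWeakTopology E ψ, _] (Subtype.val : MPsi E ψ → ProbabilityMeasure E) := by
  let := psiWeakTopology E ψ
  refine ProbabilityMeasure.continuous_iff_forall_continuous_integral.2 fun g => ?_
  refine continuous_integral_psiWeakTopology g.continuous (C := ‖g‖) fun x => ?_
  exact (g.norm_coe_le_norm x).trans (le_mul_of_one_le_right (norm_nonneg g) (hψ1 x))

/-- Normalizing the measure with density `ψ` identifies the `ψ`-weak topology with the weak
topology on probability measures. -/
theorem exists_homeomorph_psiWeakTopology [TopologicalSpace E] [OpensMeasurableSpace E]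
    (hψc : Continuous ψ) (hψ1 : ∀ x, 1 ≤ ψ x) :
    Nonempty (@Homeomorph (MPsi E ψ) (ProbabilityMeasure E) (psiWeakTopology E ψ) _) := by
  let := psiWeakTopology E ψ
  have hψ0 (x) : 0 < ψ x := one_pos.trans_le (hψ1 x)
  have hexp (x) : Real.exp (Real.log (ψ x)) = ψ x := Real.exp_log (hψ0 x)
  have hexpneg (x) : Real.exp (-Real.log (ψ x)) = (ψ x)⁻¹ := by rw [Real.exp_neg, hexp]
  have hexpneg' (x) : Real.exp ((-fun x => Real.log (ψ x)) x) = (ψ x)⁻¹ := hexpneg x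
  have hint (μ : MPsi E ψ) : Integrable (fun x => Real.exp (Real.log (ψ x))) (μ.1 : Measure E) := by
    simpa only [hexp] using μ.2
  have hintneg (μ : ProbabilityMeasure E) :
      Integrable (fun x => Real.exp ((-fun x => Real.log (ψ x)) x)) (μ : Measure E) :=
    integrable_exp_neg_log hψc hψ1 _
  have hinv : Continuous fun x => (ψ x)⁻¹ := hψc.inv₀ fun x => (hψ0 x).ne'
  refine ⟨{
    toFun := fun μ => ⟨(μ.1 : Measure E).tilted fun x => Real.log (ψ x),
      isProbabilityMeasure_tilted (hint μ)⟩
    invFun := fun ν => ⟨⟨(ν : Measure E).tilted (-fun x => Real.log (ψ x)),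
      isProbabilityMeasure_tilted (hintneg ν)⟩, ?_⟩
    left_inv := fun μ => ?_
    right_inv := fun ν => ?_
    continuous_toFun := ?_
    continuous_invFun := ?_ }⟩
  · refine (integrable_tilted_iff (hintneg ν) ψ).2 ?_
    simp only [hexpneg', smul_eq_mul, inv_mul_cancel₀ (hψ0 _).ne']
    exact integrable_const _
  · exact Subtype.ext (Subtype.ext (tilted_neg_same (hint μ)))
  · refine Subtype.ext ?_
    have h := tilted_neg_same (hintneg ν)
    rwa [neg_neg] at h
  · refine ProbabilityMeasure.continuous_iff_forall_continuous_integral.2 fun g => ?_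
    have h1 := continuous_integral_psiWeakTopology (ψ := ψ) hψc (C := 1) fun x => by
      rw [one_mul, abs_of_pos (hψ0 x)]
    have h2 := continuous_integral_psiWeakTopology (ψ := ψ) (hψc.mul g.continuous) (C := ‖g‖)
      fun x => by
        rw [Pi.mul_apply, abs_mul, abs_of_pos (hψ0 x), mul_comm]
        exact mul_le_mul_of_nonneg_right (g.norm_coe_le_norm x) (hψ0 x).le
    refine (h2.div h1 fun μ => ?_).congr fun μ => ?_
    · simpa only [hexp] using (integral_exp_pos (hint μ)).ne'
    · simp only [ProbabilityMeasure.coe_mk, integral_tilted, hexp, smul_eq_mul, div_mul_eq_mul_div,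
        integral_div]
      rfl
  · refine continuous_psiWeakTopology_iff.2 fun f hf hC => ?_
    obtain ⟨C, hC⟩ := hC
    let w : BoundedContinuousFunction E ℝ := .ofNormedAddCommGroup (fun x => (ψ x)⁻¹) hinv 1
      fun x => by
        rw [norm_inv, Real.norm_of_nonneg (hψ0 x).le]
        exact inv_le_one_of_one_le₀ (hψ1 x)
    let g : BoundedContinuousFunction E ℝ :=
      .ofNormedAddCommGroup (fun x => (ψ x)⁻¹ * f x) (hinv.mul hf) C fun x => by
        rw [norm_mul, norm_inv, Real.norm_of_nonneg (hψ0 x).le, inv_mul_le_iff₀ (hψ0 x), mul_comm]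
        exact hC x
    refine ((ProbabilityMeasure.continuous_integral_boundedContinuousFunction g).div
      (ProbabilityMeasure.continuous_integral_boundedContinuousFunction w)
      fun ν => ?_).congr fun ν => ?_
    · have h := (integral_exp_pos (hintneg ν)).ne'
      simp only [hexpneg'] at h
      exact h
    · simp only [ProbabilityMeasure.coe_mk, integral_tilted, hexpneg', smul_eq_mul,
        div_mul_eq_mul_div, integral_div]
      rfl

theorem induced_prod_eq_psiWeakTopology [TopologicalSpace E] [OpensMeasurableSpace E]
    (hψc : Continuous ψ) (hψ1 : ∀ x, 1 ≤ ψ x) :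
    TopologicalSpace.induced (fun μ : MPsi E ψ => (μ.1, ∫ x, ψ x ∂(μ.1 : Measure E)))
      inferInstance = psiWeakTopology E ψ := by
  refine le_antisymm ?_ ?_
  · let := TopologicalSpace.induced (fun μ : MPsi E ψ => (μ.1, ∫ x, ψ x ∂(μ.1 : Measure E)))
      inferInstance
    have h : Continuous fun μ : MPsi E ψ => (μ.1, ∫ x, ψ x ∂(μ.1 : Measure E)) :=
      continuous_induced_dom
    rw [← continuous_id_iff_le, continuous_psiWeakTopology_iff]
    rintro f hf ⟨C, hC⟩
    exact continuous_integral_of_abs_le_mul h.fst hψc (fun μ => μ.2) h.snd hf hC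
  · let := psiWeakTopology E ψ
    rw [← continuous_iff_le_induced]
    refine (continuous_val_psiWeakTopology hψ1).prodMk
      (continuous_integral_psiWeakTopology hψc (C := 1) fun x => ?_)
    rw [one_mul, abs_of_pos (one_pos.trans_le (hψ1 x))]

end Psi

/-- `𝔐₁^ψ(E)` endowed with the `ψ`-weak topology is a Polish space, and the `ψ`-weak topology
is generated by the distance `d_ψ(μ,ν) = π(μ,ν) + |∫ψ dμ − ∫ψ dν|`. -/
theorem mPsi_polish_and_metrized_by_dPsi (E : Type*) [MetricSpace E] [PolishSpace E]
    [MeasurableSpace E] [BorelSpace E]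
    (ψ : E → ℝ) (hψc : Continuous ψ) (hψ1 : ∀ x, 1 ≤ ψ x) :
    @PolishSpace (MPsi E ψ) (psiWeakTopology E ψ) ∧
    ∃ m : MetricSpace (MPsi E ψ),
      (∀ μ ν : MPsi E ψ,
        m.toDist.dist μ ν = dPsi ψ (μ.1 : Measure E) (ν.1 : Measure E)) ∧
      m.toUniformSpace.toTopologicalSpace = psiWeakTopology E ψ := by
  constructor
  · have := polishSpace_probabilityMeasure (E := E)
    let := psiWeakTopology E ψ
    obtain ⟨h⟩ := exists_homeomorph_psiWeakTopology hψc hψ1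
    exact h.isClosedEmbedding.polishSpace
  let Φ : MPsi E ψ → WithLp 1 (LevyProkhorov (ProbabilityMeasure E) × ℝ) := fun μ =>
    WithLp.toLp 1 (.ofMeasure μ.1, ∫ x, ψ x ∂(μ.1 : Measure E))
  have hΦ : Function.Injective Φ := fun μ ν h =>
    Subtype.ext (congrArg (fun p => p.fst.toMeasure) h)
  refine ⟨MetricSpace.induced Φ hΦ inferInstance, fun μ ν => ?_, ?_⟩
  · change dist (Φ μ) (Φ ν) = _
    rw [WithLp.prod_dist_eq_add (by simp)]
    simp only [ENNReal.toReal_one, Real.rpow_one, div_one]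
    rw [dPsi, prohorovDist_eq_levyProkhorovDist]
    rfl
  · change TopologicalSpace.induced Φ _ = _
    rw [← induced_prod_eq_psiWeakTopology hψc hψ1]
    let e : ProbabilityMeasure E × ℝ ≃ₜ WithLp 1 (LevyProkhorov (ProbabilityMeasure E) × ℝ) :=
      (LevyProkhorov.probabilityMeasureHomeomorph.prodCongr (Homeomorph.refl ℝ)).trans
        (WithLp.homeomorphProd 1 _ _).symm
    rw [e.isInducing.eq_induced, induced_compose]
    rfl
end

section
/- If the sequence ξ = (ξ₁, ξ₂, …) is stationary and the law of ξ₁ belongs to 𝔐₁^ψ(E) (i.e. ∫_E ψ d(ℙ∘ξ₁^{-1}) < ∞), then ℙ-almost surely the empirical measures m_n converge to the canonical random measure υ in the ψ-weak topology, as n → ∞; equivalently, ℙ-almost surely d_ψ(m_n, υ) → 0. -/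
open MeasureTheory Filter Topology
open scoped ENNReal NNReal

/-- The empirical measure `m_{n+1}(ω) = (n+1)⁻¹ ∑_{i=0}^{n} δ_{ω i}` of the first `n+1`
observations (coordinates) of the sequence `ω : ℕ → E`. -/
noncomputable def empMeasure (E : Type*) [MeasurableSpace E] (n : ℕ) (ω : ℕ → E) :
    MeasureTheory.Measure E :=
  ((n : ℝ≥0∞) + 1)⁻¹ • ∑ i ∈ Finset.range (n + 1), MeasureTheory.Measure.dirac (ω i)

/-- The empirical measure as a probability measure. -/
noncomputable def empirical (E : Type*) [MeasurableSpace E] (n : ℕ) (ω : ℕ → E) :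
    MeasureTheory.ProbabilityMeasure E :=
  ⟨empMeasure E n ω, by
    constructor
    simp [empMeasure, Measure.smul_apply, Finset.sum_apply]
    rw [ENNReal.inv_mul_cancel] <;> simp⟩

/-- The shift operator `Σ(x₁,x₂,…) = (x₂,x₃,…)` on `E^ℕ`. -/
def shift {E : Type*} (ω : ℕ → E) : ℕ → E := fun n => ω (n + 1)

/-- The shift-invariant σ-algebra `ℐ = {I ∈ ℰ^ℕ : Σ⁻¹(I) = I}` on `E^ℕ` (identified, via the
coordinate process `ξ`, with `ξ⁻¹ℐ`). -/
def shiftInvariantSigma (E : Type*) [MeasurableSpace E] : MeasurableSpace (ℕ → E) where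
  MeasurableSet' I := MeasurableSet I ∧ shift ⁻¹' I = I
  measurableSet_empty := ⟨MeasurableSet.empty, by simp⟩
  measurableSet_compl := fun s hs => ⟨hs.1.compl, by rw [Set.preimage_compl, hs.2]⟩
  measurableSet_iUnion := fun s hs =>
    ⟨MeasurableSet.iUnion fun i => (hs i).1, by simp [Set.preimage_iUnion, fun i => (hs i).2]⟩

/-- `birkhoffMax T f n x` is `max_{1 ≤ k ≤ n+1} ∑_{i<k} f (T^i x)`, in recursive form. -/
noncomputable def birkhoffMax {α : Type*} (T : α → α) (f : α → ℝ) : ℕ → α → ℝ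
  | 0 => f
  | n + 1 => fun x => f x + max 0 (birkhoffMax T f n (T x))

namespace BirkhoffMax

variable {α : Type*} {T : α → α} {f : α → ℝ}

lemma le_succ (n : ℕ) (x : α) : birkhoffMax T f n x ≤ birkhoffMax T f (n + 1) x := by
  induction n generalizing x with
  | zero => simp [birkhoffMax]
  | succ n ih =>
    have := ih (T x)
    simp only [birkhoffMax] at this ⊢
    gcongr

lemma mono (x : α) : Monotone fun n => birkhoffMax T f n x :=
  monotone_nat_of_le_succ fun n => le_succ n x

lemma birkhoffSum_succ_le (n : ℕ) (x : α) : birkhoffSum T f (n + 1) x ≤ birkhoffMax T f n x := by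
  induction n generalizing x with
  | zero => simp [birkhoffMax]
  | succ n ih =>
    rw [birkhoffSum_succ']
    simp only [birkhoffMax]
    gcongr
    exact (ih (T x)).trans (le_max_right _ _)

/-- The set of points at which the partial maxima are unbounded. -/
def divergenceSet (T : α → α) (f : α → ℝ) : Set α :=
  {x | ¬ ∃ C : ℕ, ∀ n, birkhoffMax T f n x ≤ C}

lemma preimage_divergenceSet : T ⁻¹' divergenceSet T f = divergenceSet T f := by
  ext x
  simp only [divergenceSet, Set.mem_preimage, Set.mem_ofPred_eq, not_iff_not]
  constructor
  · rintro ⟨C, hC⟩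
    obtain ⟨D, hD⟩ := exists_nat_ge (f x + C)
    refine ⟨D, fun n => (le_succ n x).trans (le_trans ?_ hD)⟩
    simp only [birkhoffMax]
    gcongr
    exact max_le (Nat.cast_nonneg C) (hC n)
  · rintro ⟨C, hC⟩
    obtain ⟨D, hD⟩ := exists_nat_ge (C - f x)
    refine ⟨D, fun n => le_trans ?_ hD⟩
    have := hC (n + 1)
    simp only [birkhoffMax] at this
    linarith [le_max_right 0 (birkhoffMax T f n (T x))]

lemma tendsto_atTop {x : α} (hx : x ∈ divergenceSet T f) :
    Tendsto (fun n => birkhoffMax T f n x) atTop atTop := by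
  refine tendsto_atTop_atTop_of_monotone (mono x) fun b => ?_
  by_contra! h
  obtain ⟨C, hC⟩ := exists_nat_ge b
  exact hx ⟨C, fun n => (h n).le.trans hC⟩

variable [MeasurableSpace α]

lemma measurable (hT : Measurable T) (hf : Measurable f) (n : ℕ) :
    Measurable (birkhoffMax T f n) := by
  induction n with
  | zero => exact hf
  | succ n ih => exact hf.add (measurable_const.max (ih.comp hT))

lemma measurableSet_divergenceSet (hT : Measurable T) (hf : Measurable f) :
    MeasurableSet (divergenceSet T f) := by
  have : divergenceSet T f = (⋃ C : ℕ, ⋂ n, {x | birkhoffMax T f n x ≤ C})ᶜ := by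
    ext x; simp [divergenceSet]
  rw [this]
  exact (MeasurableSet.iUnion fun C => MeasurableSet.iInter fun n =>
    measurableSet_le (measurable hT hf n) measurable_const).compl

lemma integrable {μ : Measure α} [IsFiniteMeasure μ] (hT : MeasurePreserving T μ μ)
    (hf : Integrable f μ) (n : ℕ) : Integrable (birkhoffMax T f n) μ := by
  induction n with
  | zero => exact hf
  | succ n ih => exact hf.add ((integrable_zero α ℝ μ).sup (hT.integrable_comp_of_integrable ih))

lemma setIntegral_divergenceSet_nonneg {μ : Measure α} [IsFiniteMeasure μ]
    (hT : MeasurePreserving T μ μ) (hfm : Measurable f) (hf : Integrable f μ) :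
    0 ≤ ∫ x in divergenceSet T f, f x ∂μ := by
  set A := divergenceSet T f with hA
  have hAm : MeasurableSet A := measurableSet_divergenceSet hT.measurable hfm
  have hTA : MeasurePreserving T (μ.restrict A) (μ.restrict A) := by
    have := hT.restrict_preimage hAm
    rwa [hA, preimage_divergenceSet] at this
  have hint n : Integrable (birkhoffMax T f n) (μ.restrict A) := (integrable hT hf n).restrict
  have hintT n : Integrable (fun x => birkhoffMax T f n (T x)) (μ.restrict A) :=
    hTA.integrable_comp_of_integrable (hint n)
  have hlim : Tendsto (fun n => ∫ x in A, (birkhoffMax T f (n + 1) x - birkhoffMax T f n (T x)) ∂μ)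
      atTop (𝓝 (∫ x in A, f x ∂μ)) := by
    refine tendsto_integral_of_dominated_convergence
      (fun x => |f x| + |birkhoffMax T f 0 (T x)|)
      (fun n => ((hint (n + 1)).sub (hintT n)).aestronglyMeasurable)
      (hf.restrict.abs.add (hintT 0).abs) (fun n => ae_of_all _ fun x => ?_) ?_
    · have h0 := mono (T := T) (f := f) (T x) (Nat.zero_le n)
      simp only [birkhoffMax, Real.norm_eq_abs] at h0 ⊢
      rcases max_cases 0 (birkhoffMax T f n (T x)) with h | h <;> rw [h.1] <;>
        refine abs_le.2 ⟨?_, ?_⟩ <;>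
        linarith [neg_abs_le (f x), le_abs_self (f x), neg_abs_le (f (T x)),
          le_abs_self (f (T x)), abs_nonneg (f (T x))]
    · filter_upwards [ae_restrict_mem hAm] with x hx
      have hTx : T x ∈ divergenceSet T f := by
        rw [← Set.mem_preimage, preimage_divergenceSet]; exact hx
      refine tendsto_const_nhds.congr' ?_
      filter_upwards [(tendsto_atTop hTx).eventually_ge_atTop 0] with n hn
      simp [birkhoffMax, max_eq_right hn]
  refine ge_of_tendsto' hlim fun n => ?_
  have hcomp : ∫ x in A, birkhoffMax T f n (T x) ∂μ = ∫ x in A, birkhoffMax T f n x ∂μ := by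
    have := integral_map (μ := μ.restrict A) hTA.measurable.aemeasurable (f := birkhoffMax T f n)
      (measurable hT.measurable hfm n).aestronglyMeasurable
    rw [← this, hTA.map_eq]
  rw [integral_sub (hint _) (hintT n), hcomp, sub_nonneg]
  exact integral_mono (hint n) (hint _) fun x => le_succ n x

end BirkhoffMax

section Birkhoff

variable {α : Type*} [MeasurableSpace α] {T : α → α} {f : α → ℝ} {μ : Measure α}
  [IsFiniteMeasure μ]

lemma ae_birkhoffSum_bddAbove_of_condExp_neg (hT : MeasurePreserving T μ μ) (hfm : Measurable f)
    (hf : Integrable f μ) {ε : ℝ} (hε : 0 < ε)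
    (hc : μ[f | MeasurableSpace.invariants T] =ᵐ[μ] fun _ => -ε) :
    ∀ᵐ x ∂μ, ∃ C : ℝ, ∀ n, birkhoffSum T f (n + 1) x ≤ C := by
  set A := BirkhoffMax.divergenceSet T f with hA
  have hAm : MeasurableSet A := BirkhoffMax.measurableSet_divergenceSet hT.measurable hfm
  have h0 := BirkhoffMax.setIntegral_divergenceSet_nonneg hT hfm hf
  rw [← setIntegral_condExp (MeasurableSpace.invariants_le T) hf
    (MeasurableSpace.measurableSet_invariants.2 ⟨hAm, BirkhoffMax.preimage_divergenceSet⟩),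
    integral_congr_ae (ae_restrict_of_ae hc), setIntegral_const, smul_eq_mul] at h0
  have hμA : μ A = 0 := by
    have : μ.real A = 0 := le_antisymm (by nlinarith) measureReal_nonneg
    simpa [measureReal_def, ENNReal.toReal_eq_zero_iff] using this
  filter_upwards [measure_eq_zero_iff_ae_notMem.1 hμA] with x hx
  simp only [hA, BirkhoffMax.divergenceSet, Set.mem_ofPred_eq, not_not] at hx
  obtain ⟨C, hC⟩ := hx
  exact ⟨C, fun n => (BirkhoffMax.birkhoffSum_succ_le n x).trans (hC n)⟩

lemma ae_birkhoffSum_le_condExp_add (hT : MeasurePreserving T μ μ) (hfm : Measurable f)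
    (hf : Integrable f μ) {ε : ℝ} (hε : 0 < ε) :
    ∀ᵐ x ∂μ, ∃ C : ℝ, ∀ n : ℕ, birkhoffSum T f (n + 1) x ≤
      (n + 1) * ((μ[f | MeasurableSpace.invariants T]) x + ε) + C := by
  set g := μ[f | MeasurableSpace.invariants T] with hg
  have hgI : StronglyMeasurable[MeasurableSpace.invariants T] g := stronglyMeasurable_condExp
  have hgT : (fun x => g x + ε) ∘ T = fun x => g x + ε :=
    MeasurableSpace.comp_eq_of_measurable_invariants (hgI.measurable.add_const ε)
  have hgi : Integrable (fun x => g x + ε) μ := integrable_condExp.add (integrable_const ε)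
  have hgεI : StronglyMeasurable[MeasurableSpace.invariants T] fun x => g x + ε :=
    hgI.add stronglyMeasurable_const
  have hgm : Measurable fun x => g x + ε :=
    (hgεI.mono (MeasurableSpace.invariants_le T)).measurable
  have hc : μ[f - (fun x => g x + ε) | MeasurableSpace.invariants T] =ᵐ[μ] fun _ => -ε := by
    filter_upwards [condExp_sub hf hgi (MeasurableSpace.invariants T)] with x hx
    rw [hx, Pi.sub_apply,
      condExp_of_stronglyMeasurable (MeasurableSpace.invariants_le T) hgεI hgi]
    simp [hg]
  filter_upwards [ae_birkhoffSum_bddAbove_of_condExp_neg hT (hfm.sub hgm) (hf.sub hgi) hε hc]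
    with x ⟨C, hC⟩
  refine ⟨C, fun n => ?_⟩
  have := hC n
  rw [birkhoffSum_sub, birkhoffSum_of_comp_eq hgT] at this
  simp only [Pi.smul_apply, nsmul_eq_mul, Nat.cast_add, Nat.cast_one] at this
  linarith

lemma ae_eventually_birkhoffAverage_lt (hT : MeasurePreserving T μ μ) (hfm : Measurable f)
    (hf : Integrable f μ) :
    ∀ᵐ x ∂μ, ∀ ε > 0, ∀ᶠ n : ℕ in atTop, birkhoffAverage ℝ T f (n + 1) x <
      (μ[f | MeasurableSpace.invariants T]) x + ε := by
  have h := ae_all_iff.2 fun k : ℕ =>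
    ae_birkhoffSum_le_condExp_add hT hfm hf (Nat.one_div_pos_of_nat (α := ℝ) (n := k))
  filter_upwards [h] with x hx ε hε
  obtain ⟨k, hk⟩ := exists_nat_one_div_lt hε
  obtain ⟨C, hC⟩ := hx k
  have hlim : Tendsto (fun n : ℕ => C / ((n : ℝ) + 1)) atTop (𝓝 0) :=
    tendsto_const_nhds.div_atTop (tendsto_natCast_atTop_atTop.atTop_add tendsto_const_nhds)
  filter_upwards [hlim.eventually_lt_const (sub_pos.2 hk)] with n hn
  have hpos : (0 : ℝ) < n + 1 := by positivity
  have hCn := hC n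
  rw [birkhoffAverage, smul_eq_mul, Nat.cast_add, Nat.cast_one, inv_mul_lt_iff₀ hpos]
  rw [div_lt_iff₀ hpos] at hn
  nlinarith

/-- **Birkhoff's pointwise ergodic theorem**: Birkhoff averages of an integrable function converge
almost everywhere to its conditional expectation given the invariant σ-algebra. -/
theorem ae_tendsto_birkhoffAverage_condExp (hT : MeasurePreserving T μ μ) (hfm : Measurable f)
    (hf : Integrable f μ) :
    ∀ᵐ x ∂μ, Tendsto (fun n => birkhoffAverage ℝ T f (n + 1) x) atTop
      (𝓝 ((μ[f | MeasurableSpace.invariants T]) x)) := by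
  filter_upwards [ae_eventually_birkhoffAverage_lt hT hfm hf,
    ae_eventually_birkhoffAverage_lt hT hfm.neg hf.neg,
    condExp_neg f (MeasurableSpace.invariants T)] with x h1 h2 h3
  refine tendsto_order.2 ⟨fun a ha => ?_, fun a ha => ?_⟩
  · filter_upwards [h2 _ (sub_pos.2 ha)] with n hn
    rw [h3, birkhoffAverage_neg] at hn
    simp only [Pi.neg_apply] at hn
    linarith
  · filter_upwards [h1 _ (sub_pos.2 ha)] with n hn
    linarith

end Birkhoff

/-- Integrating a nonnegative function against a regular conditional distribution of `X` given `m`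
yields its conditional expectation. -/
lemma integral_ae_eq_condExp_of_setLIntegral_eq {α β : Type*} {m m₀ : MeasurableSpace α}
    [MeasurableSpace β] {μ : Measure α} [IsFiniteMeasure μ] (hm : m ≤ m₀) {X : α → β}
    (hX : Measurable X) {κ : α → Measure β}
    (hκm : ∀ B, MeasurableSet B → Measurable[m] fun a => κ a B)
    (hκ : ∀ B, MeasurableSet B → ∀ A, MeasurableSet[m] A →
      ∫⁻ a in A, κ a B ∂μ = μ (A ∩ X ⁻¹' B))
    {g : β → ℝ} (hg : Measurable g) (hg0 : ∀ b, 0 ≤ g b)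
    (hgi : Integrable (fun a => g (X a)) μ) :
    (fun a => ∫ b, g b ∂κ a) =ᵐ[μ] μ[fun a => g (X a) | m] := by
  have hκ' : Measurable[m] κ := Measure.measurable_of_measurable_coe κ hκm
  have hκ₀ : Measurable κ := hκ'.mono hm le_rfl
  have hgo : Measurable fun b => ENNReal.ofReal (g b) := hg.ennreal_ofReal
  set h : α → ℝ≥0∞ := fun a => ∫⁻ b, ENNReal.ofReal (g b) ∂κ a with hh
  have hhm : Measurable[m] h := (Measure.measurable_lintegral hgo).comp hκ'
  have hhm₀ : Measurable h := hhm.mono hm le_rfl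
  have hset : ∀ A, MeasurableSet[m] A →
      ∫⁻ a in A, h a ∂μ = ∫⁻ a in A, ENNReal.ofReal (g (X a)) ∂μ := by
    intro A hA
    have hbind : (μ.restrict A).bind κ = (μ.restrict A).map X := by
      ext B hB
      rw [Measure.bind_apply hB hκ₀.aemeasurable, Measure.map_apply hX hB, hκ B hB A hA,
        Measure.restrict_apply (hX hB), Set.inter_comm]
    rw [hh, ← Measure.lintegral_bind hκ₀.aemeasurable hgo.aemeasurable, hbind,
      lintegral_map hgo hX]
  have hfin : ∫⁻ a, h a ∂μ ≠ ∞ := by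
    have := hset Set.univ MeasurableSet.univ
    simp only [Measure.restrict_univ] at this
    rw [this]
    exact hgi.lintegral_lt_top.ne
  have heq : (fun a => ∫ b, g b ∂κ a) = fun a => (h a).toReal := by
    ext a
    exact integral_eq_lintegral_of_nonneg_ae (ae_of_all _ hg0) hg.aestronglyMeasurable
  rw [heq]
  refine ae_eq_condExp_of_forall_setIntegral_eq hm hgi
    (fun s _ _ => (integrable_toReal_of_lintegral_ne_top hhm₀.aemeasurable hfin).integrableOn)
    (fun s hs _ => ?_) hhm.ennreal_toReal.stronglyMeasurable.aestronglyMeasurable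
  rw [integral_toReal hhm₀.aemeasurable (ae_restrict_of_ae (ae_lt_top hhm₀ hfin)), hset s hs,
    integral_eq_lintegral_of_nonneg_ae (ae_of_all _ fun a => hg0 _)
      (hg.comp hX).aestronglyMeasurable]

lemma shift_iterate_apply_zero {E : Type*} (i : ℕ) (ω : ℕ → E) : (shift^[i] ω) 0 = ω i := by
  induction i generalizing ω with
  | zero => rfl
  | succ i ih => rw [Function.iterate_succ_apply, ih]; rfl

lemma integral_empMeasure {E : Type*} [MeasurableSpace E] [MeasurableSingletonClass E]
    (g : E → ℝ) (n : ℕ) (ω : ℕ → E) :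
    ∫ x, g x ∂empMeasure E n ω = birkhoffAverage ℝ shift (fun ω => g (ω 0)) (n + 1) ω := by
  rw [empMeasure, integral_smul_measure,
    integral_finsetSum_measure fun i _ => integrable_dirac (by simp)]
  simp only [integral_dirac, birkhoffAverage, birkhoffSum, shift_iterate_apply_zero]
  congr 1
  rw [ENNReal.toReal_inv, ENNReal.toReal_add (by simp) (by simp)]
  simp

lemma prohorovDist_nonneg {E : Type*} [PseudoMetricSpace E] [MeasurableSpace E]
    (μ ν : Measure E) : 0 ≤ prohorovDist μ ν :=
  Real.sInf_nonneg fun _ hε => hε.1.le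

lemma prohorovDist_le_levyProkhorovDist {E : Type*} [PseudoMetricSpace E] [MeasurableSpace E]
    (μ ν : Measure E) [IsFiniteMeasure μ] [IsFiniteMeasure ν] :
    prohorovDist μ ν ≤ levyProkhorovDist μ ν := by
  refine le_of_forall_gt_imp_ge_of_dense fun c hc => ?_
  have hc0 : 0 < c := ENNReal.toReal_nonneg.trans_lt hc
  refine csInf_le ⟨0, fun ε hε => hε.1.le⟩ ⟨hc0, fun B hB => ?_⟩
  have hlt : levyProkhorovEDist μ ν < ENNReal.ofReal c :=
    (ENNReal.lt_ofReal_iff_toReal_lt (levyProkhorovEDist_ne_top μ ν)).2 hc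
  have := left_measure_le_of_levyProkhorovEDist_lt hlt hB
  rwa [ENNReal.toReal_ofReal hc0.le] at this

lemma tendsto_prohorovDist {E : Type*} [PseudoMetricSpace E] [TopologicalSpace.SeparableSpace E]
    [MeasurableSpace E] [OpensMeasurableSpace E] {P : ℕ → ProbabilityMeasure E}
    {Q : ProbabilityMeasure E} (h : Tendsto P atTop (𝓝 Q)) :
    Tendsto (fun n => prohorovDist (P n : Measure E) (Q : Measure E)) atTop (𝓝 0) := by
  have h1 := (LevyProkhorov.continuous_ofMeasure_probabilityMeasure.tendsto Q).comp h
  rw [tendsto_iff_dist_tendsto_zero] at h1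
  exact squeeze_zero (fun n => prohorovDist_nonneg _ _)
    (fun n => prohorovDist_le_levyProkhorovDist _ _) h1

/-- The finite unions of members of a countable basis. -/
def basisFiniteUnions (E : Type*) [TopologicalSpace E] [SecondCountableTopology E] :
    Set (Set E) :=
  Set.sUnion '' {F : Set (Set E) | F.Finite ∧ F ⊆ TopologicalSpace.countableBasis E}

lemma countable_basisFiniteUnions (E : Type*) [TopologicalSpace E] [SecondCountableTopology E] :
    (basisFiniteUnions E).Countable :=
  (Set.countable_ofPred_finite_subset (TopologicalSpace.countable_countableBasis E)).image _

lemma isOpen_of_mem_basisFiniteUnions {E : Type*} [TopologicalSpace E]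
    [SecondCountableTopology E] {U : Set E} (hU : U ∈ basisFiniteUnions E) : IsOpen U := by
  obtain ⟨F, hF, rfl⟩ := hU
  exact isOpen_sUnion fun t ht => TopologicalSpace.isOpen_of_mem_countableBasis (hF.2 ht)

/-- Convergence of the masses of finite unions of basic open sets implies weak convergence. -/
lemma tendsto_probabilityMeasure_of_basisFiniteUnions {E : Type*} [TopologicalSpace E]
    [SecondCountableTopology E] [MeasurableSpace E] [OpensMeasurableSpace E]
    {P : ℕ → ProbabilityMeasure E} {Q : ProbabilityMeasure E}
    (h : ∀ U ∈ basisFiniteUnions E,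
      Tendsto (fun n => (P n : Measure E) U) atTop (𝓝 ((Q : Measure E) U))) :
    Tendsto P atTop (𝓝 Q) := by
  refine tendsto_of_forall_isOpen_le_liminf_nat' fun G hG => ?_
  obtain ⟨S, hS, rfl⟩ := (TopologicalSpace.isBasis_countableBasis E).open_eq_sUnion hG
  have : Countable S := ((TopologicalSpace.countable_countableBasis E).mono hS).to_subtype
  have hdir : Directed (· ⊆ ·) fun s : Finset S => ⋃ i ∈ s, (i : Set E) :=
    directed_of_isDirected_le fun s t hst => Set.biUnion_subset_biUnion_left hst
  have hmeas : (Q : Measure E) (⋃₀ S) = ⨆ s : Finset S, (Q : Measure E) (⋃ i ∈ s, (i : Set E)) := by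
    rw [← hdir.measure_iUnion, ← Set.iUnion_eq_iUnion_finset, Set.sUnion_eq_iUnion]
  rw [hmeas]
  refine iSup_le fun s => ?_
  have hs : (⋃ i ∈ s, (i : Set E)) ∈ basisFiniteUnions E := by
    refine ⟨Subtype.val '' (s : Set S), ⟨s.finite_toSet.image _, ?_⟩, ?_⟩
    · rintro _ ⟨i, -, rfl⟩
      exact hS i.2
    · rw [Set.sUnion_image]; simp
  rw [← (h _ hs).liminf_eq]
  refine liminf_le_liminf (Eventually.of_forall fun n => measure_mono ?_)
  exact Set.iUnion₂_subset fun i _ => Set.subset_sUnion_of_mem i.2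

/-- **Varadarajan-type theorem for the ψ-weak topology.** If the coordinate sequence
`ξ = (ξ₁, ξ₂, …)` on `Ω = E^ℕ` is stationary and the law of `ξ₁` integrates the gauge `ψ`,
then `ℙ`-almost surely the empirical measures `m_n` converge in the `ψ`-weak topology to the
canonical random measure `υ` (a regular version of `ℙ[ξ₁ ∈ · | ξ⁻¹ℐ]`); equivalently,
`ℙ`-almost surely `d_ψ(m_n, υ) → 0` as `n → ∞`. -/
theorem empirical_tendsto_psiWeak_of_stationary (E : Type*) [MetricSpace E] [PolishSpace E]
    [MeasurableSpace E] [BorelSpace E]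
    (ψ : E → ℝ) (hψc : Continuous ψ) (hψ1 : ∀ x, 1 ≤ ψ x)
    (ℙ : Measure (ℕ → E)) [IsProbabilityMeasure ℙ]
    (hstat : ℙ.map shift = ℙ)
    (hint : Integrable ψ (ℙ.map fun ω => ω 0))
    (υ : (ℕ → E) → ProbabilityMeasure E)
    (hυmeas : ∀ B : Set E, MeasurableSet B →
      Measurable[shiftInvariantSigma E] fun ω => (υ ω : Measure E) B)
    (hυcond : ∀ B : Set E, MeasurableSet B → ∀ A : Set (ℕ → E),
      MeasurableSet[shiftInvariantSigma E] A →
      ∫⁻ ω in A, (υ ω : Measure E) B ∂ℙ = ℙ (A ∩ {ω | ω 0 ∈ B})) :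
    ∀ᵐ ω ∂ℙ, Filter.Tendsto (fun n => dPsi ψ (empMeasure E n ω) (υ ω : Measure E))
      Filter.atTop (nhds 0) := by
  have hX : Measurable fun ω : ℕ → E => ω 0 := measurable_pi_apply 0
  have hT : MeasurePreserving shift ℙ ℙ :=
    ⟨measurable_pi_lambda _ fun n => measurable_pi_apply (n + 1), hstat⟩
  have key : ∀ g : E → ℝ, Measurable g → (∀ x, 0 ≤ g x) → Integrable (fun ω => g (ω 0)) ℙ →
      ∀ᵐ ω ∂ℙ, Tendsto (fun n => ∫ x, g x ∂empMeasure E n ω) atTop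
        (𝓝 (∫ x, g x ∂(υ ω : Measure E))) := by
    intro g hg hg0 hgi
    have hc := integral_ae_eq_condExp_of_setLIntegral_eq (MeasurableSpace.invariants_le shift) hX
      (κ := fun ω => (υ ω : Measure E)) hυmeas hυcond hg hg0 hgi
    filter_upwards [ae_tendsto_birkhoffAverage_condExp hT (hg.comp hX) hgi, hc] with ω h1 h2
    simp only [integral_empMeasure, h2]
    exact h1
  have hψ := key ψ hψc.measurable (fun x => zero_le_one.trans (hψ1 x))
    (hint.comp_measurable hX)
  have hU : ∀ᵐ ω ∂ℙ, ∀ U ∈ basisFiniteUnions E,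
      Tendsto (fun n => (empirical E n ω : Measure E) U) atTop (𝓝 ((υ ω : Measure E) U)) := by
    refine (ae_ball_iff (countable_basisFiniteUnions E)).2 fun U hU => ?_
    have hUm := (isOpen_of_mem_basisFiniteUnions hU).measurableSet
    filter_upwards [key (U.indicator 1) (measurable_one.indicator hUm)
      (Set.indicator_nonneg fun _ _ => zero_le_one)
      (((integrable_const (1 : ℝ)).indicator hUm).comp_measurable hX)] with ω hω
    simp only [integral_indicator_one hUm] at hω
    exact (ENNReal.tendsto_toReal_iff (fun n => measure_ne_top (empirical E n ω : Measure E) U)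
      (measure_ne_top _ U)).1 hω
  filter_upwards [hψ, hU] with ω h1 h2
  have hP := tendsto_prohorovDist (tendsto_probabilityMeasure_of_basisFiniteUnions h2)
  have hψ0 := (tendsto_iff_dist_tendsto_zero.1 h1)
  simpa [dPsi, Real.dist_eq, empirical] using hP.add hψ0
end
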